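/- There exists an absolute constant c > 0 with the following property. Let G be an abelian group and A a finite nonempty subset of G with E₃(A) ≥ 2|A|³. Then (max_{s ≠ 0} |A − A_s|)³ ≥ c·|A|¹⁰/(|A − A|·E(A)²) and (max_{s ≠ 0} |A + A_s|)³ ≥ c·|A|¹⁰/(|A − A|·E(A)²), where the maxima are taken over all nonzero s ∈ G. -/

import Mathlib

open Finset Pointwise

universe u

variable {G : Type*} [AddCommGroup G] [DecidableEq G]

/-- `A_s = A ∩ (A - s) = {x ∈ A : x + s ∈ A}`. -/
def stab (A : Finset G) (s : G) : Finset G := A ∩ A.image (fun a => a - s)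

/-- `E_k(A) = ∑_{s ∈ G} |A_s|^k` (the summand vanishes off `A - A`). -/
def energyK (k : ℕ) (A : Finset G) : ℕ := ∑ s ∈ A - A, (stab A s).card ^ k

/-- The additive energy `E(A)`. -/
def energy (A : Finset G) : ℕ := energyK 2 A


section helpers

variable {H : Type*} [AddCommGroup H] [DecidableEq H]

lemma mem_stab' (A : Finset H) (s a : H) : a ∈ stab A s ↔ a ∈ A ∧ a + s ∈ A := by
  simp only [stab, mem_inter, mem_image]
  constructor
  · rintro ⟨h, b, hb, rfl⟩
    exact ⟨h, by simpa using hb⟩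
  · rintro ⟨h, h2⟩
    exact ⟨h, _, h2, by simp⟩

def en (A B : Finset H) : ℕ := ∑ x ∈ A - A, (stab A x).card * (stab B x).card

lemma energy_add_le (A B : Finset H) : addEnergy A B ≤ en A B := by
  have : en A B = ((A - A).sigma (fun x => stab A x ×ˢ stab B x)).card := by
    simp [en, card_sigma]
  rw [this, addEnergy]
  apply Finset.card_le_card_of_injOn (fun p => ⟨p.1.2 - p.1.1, (p.1.1, p.2.2)⟩)
  · rintro ⟨⟨a, a'⟩, b, b'⟩ h
    simp only [coe_filter, mem_product, Set.mem_ofPred_eq] at h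
    obtain ⟨⟨⟨h1, h2⟩, h3, h4⟩, h5⟩ := h
    simp only [coe_sigma, Set.mem_sigma_iff, mem_coe, mem_product, mem_stab']
    refine ⟨sub_mem_sub h2 h1, ⟨h1, by simpa using h2⟩, h4, ?_⟩
    have : b' + (a' - a) = b := by
      rw [← sub_eq_zero] at h5 ⊢
      rw [← neg_eq_zero, ← h5]; abel
    rwa [this]
  · rintro ⟨⟨a, a'⟩, b, b'⟩ h ⟨⟨c, c'⟩, d, d'⟩ h' heq
    simp only [coe_filter, mem_product, Set.mem_ofPred_eq] at h h'
    simp only [Sigma.mk.injEq, heq_eq_eq, Prod.mk.injEq] at heq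
    obtain ⟨e1, rfl, rfl⟩ := heq
    have e : a' = c' := by simpa using e1
    subst e
    have : b = d := by
      have := h.2.trans h'.2.symm
      simpa using this
    subst this; rfl

lemma energy_sub_le (A B : Finset H) : addEnergy A (-B) ≤ en A B := by
  have : en A B = ((A - A).sigma (fun x => stab A x ×ˢ stab B x)).card := by
    simp [en, card_sigma]
  rw [this, addEnergy]
  apply Finset.card_le_card_of_injOn (fun p => ⟨p.1.2 - p.1.1, (p.1.1, -p.2.1)⟩)
  · rintro ⟨⟨a, a'⟩, b, b'⟩ h
    simp only [coe_filter, mem_product, Set.mem_ofPred_eq, mem_neg'] at h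
    obtain ⟨⟨⟨h1, h2⟩, h3, h4⟩, h5⟩ := h
    simp only [coe_sigma, Set.mem_sigma_iff, mem_coe, mem_product, mem_stab']
    refine ⟨sub_mem_sub h2 h1, ⟨h1, by simpa using h2⟩, h3, ?_⟩
    have : -b + (a' - a) = -b' := by
      rw [← sub_eq_zero] at h5 ⊢
      rw [← neg_eq_zero, ← h5]; abel
    rwa [this]
  · rintro ⟨⟨a, a'⟩, b, b'⟩ h ⟨⟨c, c'⟩, d, d'⟩ h' heq
    simp only [coe_filter, mem_product, Set.mem_ofPred_eq] at h h'
    simp only [Sigma.mk.injEq, heq_eq_eq, Prod.mk.injEq, neg_inj] at heq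
    obtain ⟨e1, rfl, rfl⟩ := heq
    have e : a' = c' := by simpa using e1
    subst e
    have : b' = d' := by
      have := h.2.symm.trans h'.2
      simpa using this
    subst this; rfl

lemma L1_add (A B : Finset H) : A.card ^ 2 * B.card ^ 2 ≤ (A + B).card * en A B :=
  (le_card_add_mul_addEnergy A B).trans (Nat.mul_le_mul_left _ (energy_add_le A B))

lemma L1_sub (A B : Finset H) : A.card ^ 2 * B.card ^ 2 ≤ (A - B).card * en A B := by
  have h := (le_card_add_mul_addEnergy A (-B)).trans (Nat.mul_le_mul_left _ (energy_sub_le A B))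
  rwa [card_neg, ← sub_eq_add_neg] at h

lemma sum_stab_le (D B : Finset H) : ∑ x ∈ D, (stab B x).card ≤ B.card ^ 2 := by
  rw [← card_sigma, sq, ← card_product]
  apply Finset.card_le_card_of_injOn (fun p => (p.2, p.2 + p.1))
  · rintro ⟨x, a⟩ h
    simp only [coe_sigma, Set.mem_sigma_iff, mem_coe, mem_stab'] at h
    simpa using h.2
  · rintro ⟨x, a⟩ h ⟨y, b⟩ h' heq
    simp only [Prod.mk.injEq] at heq
    obtain ⟨rfl, h2⟩ := heq
    have : x = y := by simpa using h2
    subst this; rfl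

lemma sum_stab (A : Finset H) : ∑ x ∈ A - A, (stab A x).card = A.card ^ 2 := by
  apply le_antisymm (sum_stab_le _ _)
  rw [← card_sigma, sq, ← card_product]
  apply Finset.card_le_card_of_injOn (fun p => ⟨p.2 - p.1, p.1⟩)
  · rintro ⟨a, b⟩ h
    simp only [coe_product, Set.mem_prod, mem_coe] at h
    simp only [coe_sigma, Set.mem_sigma_iff, mem_coe, mem_stab']
    exact ⟨sub_mem_sub h.2 h.1, h.1, by simpa using h.2⟩
  · rintro ⟨a, b⟩ h ⟨c, d⟩ h' heq
    simp only [Sigma.mk.injEq, heq_eq_eq] at heq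
    obtain ⟨h2, rfl⟩ := heq
    have : b = d := by simpa using h2
    subst this; rfl

lemma stab_card_le (B : Finset H) (x : H) : (stab B x).card ≤ B.card :=
  card_le_card inter_subset_left

lemma L2 (A B : Finset H) : en A B ^ 2 ≤ energy A * B.card ^ 3 := by
  refine (sum_mul_sq_le_sq_mul_sq _ _ _).trans ?_
  refine Nat.mul_le_mul_left _ ?_
  calc ∑ x ∈ A - A, (stab B x).card ^ 2 ≤ ∑ x ∈ A - A, B.card * (stab B x).card := by
        apply sum_le_sum
        intro x _
        rw [sq]
        exact Nat.mul_le_mul_right _ (stab_card_le B x)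
    _ ≤ B.card ^ 3 := by
        rw [← mul_sum, pow_succ' _ 2]
        exact Nat.mul_le_mul_left _ (sum_stab_le _ _)

lemma sum_stab_stab (D A : Finset H) (x : H) :
    ∑ s ∈ D, (stab (stab A s) x).card ≤ (stab A x).card ^ 2 := by
  refine le_trans (le_of_eq ?_) (sum_stab_le D (stab A x))
  refine sum_congr rfl fun s _ => ?_
  congr 1
  ext a
  simp only [mem_stab']
  rw [add_right_comm a x s]
  tauto

lemma L3 (D A : Finset H) : ∑ s ∈ D, en A (stab A s) ≤ energyK 3 A := by
  unfold en energyK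
  rw [sum_comm]
  refine sum_le_sum fun x _ => ?_
  rw [← mul_sum, pow_succ' _ 2]
  exact Nat.mul_le_mul_left _ (sum_stab_stab D A x)

lemma stab_zero' (A : Finset H) : stab A 0 = A := by
  ext a; simp [mem_stab']

lemma key (A : Finset H) (hA : A.Nonempty) (f : H → ℕ)
    (hf : ∀ s, A.card ^ 2 * (stab A s).card ^ 2 ≤ f s * en A (stab A s))
    (h3 : 2 * (A.card : ℝ) ^ 3 ≤ (energyK 3 A : ℝ)) :
    ∃ s : H, s ≠ 0 ∧
      (1/8 : ℝ) * (A.card : ℝ) ^ 10 / (((A - A).card : ℝ) * (energy A : ℝ) ^ 2) ≤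
        (f s : ℝ) ^ 3 := by
  have h0 : (0 : H) ∈ A - A := by
    obtain ⟨a, ha⟩ := hA
    simpa using sub_mem_sub ha ha
  set D := (A - A).erase 0 with hD
  have s1 : A.card + ∑ s ∈ D, (stab A s).card = A.card ^ 2 := by
    rw [← sum_stab A, ← add_sum_erase _ _ h0, stab_zero']
  have s3 : A.card ^ 3 + ∑ s ∈ D, (stab A s).card ^ 3 = energyK 3 A := by
    rw [energyK, ← add_sum_erase _ _ h0, stab_zero']
  have s2 : ∑ s ∈ D, (stab A s).card ^ 2 ≤ energy A := by
    rw [energy, energyK, ← add_sum_erase _ _ h0]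
    exact Nat.le_add_left _ _
  have hn : 1 ≤ A.card := hA.card_pos
  have hDne : D.Nonempty := by
    by_contra hne
    rw [not_nonempty_iff_eq_empty] at hne
    rw [hne] at s3
    simp only [sum_empty, add_zero] at s3
    rw [← s3] at h3
    have : (1 : ℝ) ≤ (A.card : ℝ) ^ 3 := by exact_mod_cast Nat.one_le_pow _ _ hn
    push_cast at h3
    linarith
  have hn2 : 2 ≤ A.card := by
    by_contra hlt
    have h1 : A.card = 1 := by omega
    obtain ⟨a, rfl⟩ := card_eq_one.mp h1
    simp [hD] at hDne
  obtain ⟨s₀, hs₀, hmax⟩ := exists_max_image D f hDne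
  refine ⟨s₀, (mem_erase.mp hs₀).1, ?_⟩
  set M := f s₀ with hM
  have hf' : ∀ s ∈ D, A.card ^ 2 * (stab A s).card ^ 2 ≤ M * en A (stab A s) := fun s hs =>
    (hf s).trans (Nat.mul_le_mul_right _ (hmax s hs))
  have k1 : ∀ s ∈ D, A.card ^ 4 * (stab A s).card ^ 3 ≤ M ^ 2 * energy A * (stab A s).card ^ 2 := by
    intro s hs
    rcases Nat.eq_zero_or_pos (stab A s).card with hz | hp
    · simp [hz]
    have a1 := Nat.pow_le_pow_left (hf' s hs) 2
    have a2 := L2 A (stab A s)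
    have a3 : (A.card ^ 4 * (stab A s).card) * (stab A s).card ^ 3
        ≤ (M ^ 2 * energy A) * (stab A s).card ^ 3 := by
      calc _ = (A.card ^ 2 * (stab A s).card ^ 2) ^ 2 := by ring
        _ ≤ (M * en A (stab A s)) ^ 2 := a1
        _ = M ^ 2 * en A (stab A s) ^ 2 := by ring
        _ ≤ M ^ 2 * (energy A * (stab A s).card ^ 3) := Nat.mul_le_mul_left _ a2
        _ = _ := by ring
    have a4 := Nat.le_of_mul_le_mul_right a3 (by positivity)
    calc _ = (A.card ^ 4 * (stab A s).card) * (stab A s).card ^ 2 := by ring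
      _ ≤ _ := Nat.mul_le_mul_right _ a4
  have k2 : A.card ^ 4 * ∑ s ∈ D, (stab A s).card ^ 3 ≤ M ^ 2 * energy A ^ 2 := by
    calc _ ≤ M ^ 2 * energy A * ∑ s ∈ D, (stab A s).card ^ 2 := by
          rw [mul_sum, mul_sum]; exact sum_le_sum k1
      _ ≤ M ^ 2 * energy A * energy A := Nat.mul_le_mul_left _ s2
      _ = _ := by ring
  have k3 : A.card ^ 2 * (∑ s ∈ D, (stab A s).card) ^ 2 ≤ (A - A).card * (M * energyK 3 A) := by
    calc _ ≤ A.card ^ 2 * (D.card * ∑ s ∈ D, (stab A s).card ^ 2) :=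
          Nat.mul_le_mul_left _ sq_sum_le_card_mul_sum_sq
      _ = D.card * ∑ s ∈ D, A.card ^ 2 * (stab A s).card ^ 2 := by rw [← mul_sum]; ring
      _ ≤ D.card * ∑ s ∈ D, M * en A (stab A s) := Nat.mul_le_mul_left _ (sum_le_sum hf')
      _ ≤ (A - A).card * (M * energyK 3 A) := by
          rw [← mul_sum]
          exact Nat.mul_le_mul (card_le_card (erase_subset _ _)) (Nat.mul_le_mul_left _ (L3 D A))
  have hEpos : 0 < energy A := by
    have : (stab A 0).card ^ 2 ≤ energy A :=
      single_le_sum (f := fun s => (stab A s).card ^ 2) (fun _ _ => Nat.zero_le _) h0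
    rw [stab_zero'] at this
    exact lt_of_lt_of_le (by positivity) this
  have hDpos : 0 < (A - A).card := card_pos.mpr ⟨0, h0⟩
  have hEr : (0 : ℝ) < energy A := by exact_mod_cast hEpos
  have hDr : (0 : ℝ) < (A - A).card := by exact_mod_cast hDpos
  rw [div_le_iff₀ (by positivity)]
  generalize (∑ s ∈ D, (stab A s).card) = S1 at *
  generalize (∑ s ∈ D, (stab A s).card ^ 3) = S3 at *
  generalize energyK 3 A = E3 at *
  generalize energy A = E at *
  generalize (A - A).card = d at *
  generalize A.card = n at *
  have k2' : (n : ℝ) ^ 4 * S3 ≤ M ^ 2 * E ^ 2 := by exact_mod_cast k2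
  have k3' : (n : ℝ) ^ 2 * S1 ^ 2 ≤ d * (M * E3) := by exact_mod_cast k3
  have s1' : (n : ℝ) + S1 = n ^ 2 := by exact_mod_cast s1
  have s3' : (n : ℝ) ^ 3 + S3 = E3 := by exact_mod_cast s3
  have hn' : (2 : ℝ) ≤ n := by exact_mod_cast hn2
  have hS1 : (n : ℝ) ^ 2 / 2 ≤ S1 := by nlinarith
  have hS3 : (E3 : ℝ) / 2 ≤ S3 := by linarith
  have b1 : (n : ℝ) ^ 6 / 4 ≤ d * (M * E3) := by
    calc (n : ℝ) ^ 6 / 4 = (n : ℝ) ^ 2 * ((n : ℝ) ^ 2 / 2) ^ 2 := by ring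
      _ ≤ (n : ℝ) ^ 2 * (S1 : ℝ) ^ 2 := by gcongr
      _ ≤ _ := k3'
  have b2 : (n : ℝ) ^ 4 * (E3 / 2) ≤ M ^ 2 * E ^ 2 := le_trans (by gcongr) k2'
  calc (1/8 : ℝ) * (n : ℝ) ^ 10 = ((n : ℝ) ^ 6 / 4) * ((n : ℝ) ^ 4 / 2) := by ring
    _ ≤ ((d : ℝ) * ((M : ℝ) * (E3 : ℝ))) * ((n : ℝ) ^ 4 / 2) := by gcongr
    _ = (d : ℝ) * (M : ℝ) * ((n : ℝ) ^ 4 * ((E3 : ℝ) / 2)) := by ring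
    _ ≤ (d : ℝ) * (M : ℝ) * ((M : ℝ) ^ 2 * (E : ℝ) ^ 2) :=
        mul_le_mul_of_nonneg_left b2 (by positivity)
    _ = _ := by ring

end helpers

theorem stmt_3 :
    ∃ c : ℝ, 0 < c ∧
      ∀ (G : Type u) [AddCommGroup G] [DecidableEq G] (A : Finset G),
        A.Nonempty →
        2 * (A.card : ℝ) ^ 3 ≤ (energyK 3 A : ℝ) →
        (∃ s : G, s ≠ 0 ∧
            c * (A.card : ℝ) ^ 10 / (((A - A).card : ℝ) * (energy A : ℝ) ^ 2) ≤
              ((A - stab A s).card : ℝ) ^ 3) ∧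
        (∃ s : G, s ≠ 0 ∧
            c * (A.card : ℝ) ^ 10 / (((A - A).card : ℝ) * (energy A : ℝ) ^ 2) ≤
              ((A + stab A s).card : ℝ) ^ 3) := by
  refine ⟨1/8, by norm_num, ?_⟩
  intro G _ _ A hA h3
  exact ⟨key A hA (fun s => (A - stab A s).card) (fun s => L1_sub A _) h3,
    key A hA (fun s => (A + stab A s).card) (fun s => L1_add A _) h3⟩
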